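/- Let a ≥ 1 and N ≥ 2 be integers, let H_{a,N} = {k·a : 1 ≤ k ≤ 2^N}, and let ε : H_{a,N} → (0,∞) be a function satisfying 2^N · sup_{l ∈ H_{a,N}} ε(l) ≤ 1/2. Then the perturbed set H_{a,N}(ε) = {(1 + ε(l))·l : l ∈ H_{a,N}} consists of 2^N distinct elements and its Perron factor satisfies G(H_{a,N}(ε)) < 6. -/

import Mathlib

open MeasureTheory ProbabilityTheory Filter Set

/-- The `n`-th element (1-indexed) of a finite set of reals listed in increasing order. -/
noncomputable def sortedElem (U : Finset ℝ) (n : ℕ) : ℝ :=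
  (U.sort (· ≤ ·)).getD (n - 1) 0

/-- The Perron factor `G(U)` of a finite set of reals `U = {u_1 < u_2 < ⋯ < u_m}`:
`sup { (u_{k+2l} − u_{k+l})/(u_{k+l} − u_k) + (u_{k+l} − u_k)/(u_{k+2l} − u_{k+l}) :
  k ≥ 1, l ≥ 1, k + 2l ≤ m }`. -/
noncomputable def perronFactor (U : Finset ℝ) : ℝ :=
  sSup { g : ℝ | ∃ k l : ℕ, 1 ≤ k ∧ 1 ≤ l ∧ k + 2 * l ≤ U.card ∧
    g = (sortedElem U (k + 2 * l) - sortedElem U (k + l)) / (sortedElem U (k + l) - sortedElem U k)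
      + (sortedElem U (k + l) - sortedElem U k) / (sortedElem U (k + 2 * l) - sortedElem U (k + l)) }

/-- The Perron capacity `P(S) = liminf_{N→∞} inf { G(U) : U ⊆ S, #U = 2^N }`. -/
noncomputable def perronCapacity (S : Set ℝ) : EReal :=
  Filter.liminf (fun N : ℕ =>
    sInf { g : EReal | ∃ U : Finset ℝ, ↑U ⊆ S ∧ U.card = 2 ^ N ∧ g = (perronFactor U : EReal) })
    Filter.atTop

/-- The homogeneous set `H_{a,N} = {k·a : 1 ≤ k ≤ 2^N}` as a finite set of reals. -/
noncomputable def homogeneousSet (a N : ℕ) : Finset ℝ :=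
  (Finset.Icc 1 (2 ^ N)).image (fun k : ℕ => (k : ℝ) * (a : ℝ))

theorem aux_ratio (L x y : ℝ) (hL : 1 ≤ L) (hx1 : L - 1/2 ≤ x) (hx2 : x ≤ L + 1/2)
    (hy1 : L - 1/2 ≤ y) (hy2 : y ≤ L + 1/2) : x / y + y / x ≤ 10 / 3 := by
  have hx : 0 < x := by linarith
  have hy : 0 < y := by linarith
  rw [div_add_div _ _ hy.ne' hx.ne', div_le_iff₀ (by positivity)]
  nlinarith [mul_nonneg (show 0 ≤ 3 * x - y by linarith) (show 0 ≤ 3 * y - x by linarith)]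

theorem aux_sort (n : ℕ) (u : ℕ → ℝ)
    (hu : ∀ i j, 1 ≤ i → i < j → j ≤ n → u i < u j) :
    ((Finset.Icc 1 n).image u).card = n ∧
    ∀ k, 1 ≤ k → k ≤ n → sortedElem ((Finset.Icc 1 n).image u) k = u k := by
  constructor
  · rw [Finset.card_image_of_injOn]
    · simp
    · intro i hi j hj h
      simp only [Finset.coe_Icc, Set.mem_Icc] at hi hj
      rcases lt_trichotomy i j with h1 | h1 | h1
      · exact absurd h (hu i j hi.1 h1 hj.2).ne
      · exact h1
      · exact absurd h (hu j i hj.1 h1 hi.2).ne'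
  · intro k hk1 hk2
    have hp : ((List.range n).map (fun i => u (i + 1))).Pairwise (· < ·) := by
      rw [List.pairwise_map]
      refine List.Pairwise.imp_of_mem ?_ List.pairwise_lt_range
      intro i j hi hj hij
      rw [List.mem_range] at hi hj
      exact hu _ _ (by omega) (by omega) (by omega)
    have hU : (Finset.Icc 1 n).image u = ((List.range n).map (fun i => u (i + 1))).toFinset := by
      ext x
      simp only [Finset.mem_image, Finset.mem_Icc, List.mem_toFinset, List.mem_map, List.mem_range]
      constructor
      · rintro ⟨i, hi, rfl⟩
        exact ⟨i - 1, by omega, by rw [Nat.sub_add_cancel hi.1]⟩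
      · rintro ⟨i, hi, rfl⟩
        exact ⟨i + 1, by omega, rfl⟩
    have hs := (List.toFinset_sort (r := (· ≤ ·)) (hp.imp (fun h => h.ne))).2 (hp.imp le_of_lt)
    unfold sortedElem
    rw [hU, hs, List.getD_eq_getElem _ _ (by simp; omega)]
    simp [Nat.sub_add_cancel hk1]

/-- if `ε` is positive on `H_{a,N}` and `2^N · sup_{l ∈ H_{a,N}} ε(l) ≤ 1/2`, then
the perturbed set `H_{a,N}(ε) = {(1 + ε(l))·l : l ∈ H_{a,N}}` has `2^N` distinct elements and
its Perron factor is `< 6`. -/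
theorem perronFactor_perturbed_homogeneousSet (a N : ℕ) (ha : 1 ≤ a) (hN : 2 ≤ N)
    (ε : ℝ → ℝ)
    (hεpos : ∀ l ∈ homogeneousSet a N, 0 < ε l)
    (hεsmall : ∀ l ∈ homogeneousSet a N, (2 : ℝ) ^ N * ε l ≤ 1 / 2) :
    ((homogeneousSet a N).image (fun l => (1 + ε l) * l)).card = 2 ^ N ∧
    perronFactor ((homogeneousSet a N).image (fun l => (1 + ε l) * l)) < 6 := by
  have ha' : (0 : ℝ) < a := by exact_mod_cast ha
  obtain ⟨d, hd⟩ : ∃ d : ℕ → ℝ, ∀ k, d k = k * ε (k * a) := ⟨_, fun _ => rfl⟩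
  have hd0 : ∀ k, 1 ≤ k → k ≤ 2 ^ N → 0 ≤ d k ∧ d k ≤ 1 / 2 := by
    intro k h1 h2
    have hm : (k : ℝ) * a ∈ homogeneousSet a N :=
      Finset.mem_image.2 ⟨k, Finset.mem_Icc.2 ⟨h1, h2⟩, rfl⟩
    have e1 := hεpos _ hm
    have e2 := hεsmall _ hm
    have h2' : (k : ℝ) ≤ 2 ^ N := by exact_mod_cast h2
    rw [hd]
    exact ⟨by positivity, (mul_le_mul_of_nonneg_right h2' e1.le).trans e2⟩
  have himg : (homogeneousSet a N).image (fun l => (1 + ε l) * l)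
      = (Finset.Icc 1 (2 ^ N)).image (fun k : ℕ => (a : ℝ) * (k + d k)) := by
    unfold homogeneousSet
    rw [Finset.image_image]
    congr 1
    funext k
    simp only [Function.comp, hd]
    ring
  obtain ⟨hc, hs⟩ := aux_sort (2 ^ N) (fun k : ℕ => (a : ℝ) * (k + d k)) (by
    intro i j h1 h2 h3
    have hi := hd0 i h1 (by omega)
    have hj := hd0 j (by omega) h3
    have hij : (i : ℝ) + 1 ≤ j := by exact_mod_cast h2
    exact mul_lt_mul_of_pos_left (by linarith) ha')
  rw [himg]
  refine ⟨hc, lt_of_le_of_lt (b := 10 / 3) ?_ (by norm_num)⟩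
  unfold perronFactor
  apply Real.sSup_le _ (by norm_num)
  rintro g ⟨k, l, hk, hl, hkl, rfl⟩
  rw [hc] at hkl
  rw [hs k hk (by omega), hs (k + l) (by omega) (by omega), hs (k + 2 * l) (by omega) hkl]
  have h1 := hd0 k hk (by omega)
  have h2 := hd0 (k + l) (by omega) (by omega)
  have h3 := hd0 (k + 2 * l) (by omega) hkl
  have hl' : (1 : ℝ) ≤ l := by exact_mod_cast hl
  simp only [← mul_sub]
  rw [mul_div_mul_left _ _ ha'.ne', mul_div_mul_left _ _ ha'.ne']
  push_cast
  apply aux_ratio l _ _ hl' <;> linarith
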